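/- Let L and C be disjoint finite sets of natural numbers and let j ∈ C. Then σ(C∖{j},{j}) · σ(L,C) = σ(L, C∖{j}) · σ((C∖{j})∪L, {j}). (This is the first permutation identity, illustrated in Figure 2, used in the paper's proof of the Stokes theorem for the flux, Theorem 2, with C playing the role of J^c.) -/

import Mathlib

/-- Number of "inversion" pairs (a,b) ∈ A × B with b < a. -/
def invCount (A B : Finset ℕ) : ℕ :=
  ((A ×ˢ B).filter (fun p => p.2 < p.1)).card

/-- The signature σ(A,B) = (−1)^{N(A,B)} of the permutation sorting the
concatenation of the increasing enumerations of A and B. -/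
def sortSign (A B : Finset ℕ) : ℤ :=
  (-1) ^ invCount A B

theorem invCount_union_left {A B : Finset ℕ} (h : Disjoint A B) (D : Finset ℕ) :
    invCount (A ∪ B) D = invCount A D + invCount B D := by
  unfold invCount
  rw [Finset.union_product, Finset.filter_union, Finset.card_union_of_disjoint]
  exact Finset.disjoint_filter_filter (Finset.disjoint_product.mpr (Or.inl h))

theorem invCount_union_right {A B : Finset ℕ} (h : Disjoint A B) (D : Finset ℕ) :
    invCount D (A ∪ B) = invCount D A + invCount D B := by
  unfold invCount
  rw [Finset.product_union, Finset.filter_union, Finset.card_union_of_disjoint]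
  exact Finset.disjoint_filter_filter (Finset.disjoint_product.mpr (Or.inr h))

theorem sortSign_union_left {A B : Finset ℕ} (h : Disjoint A B) (D : Finset ℕ) :
    sortSign (A ∪ B) D = sortSign A D * sortSign B D := by
  simp only [sortSign, invCount_union_left h, pow_add]

theorem sortSign_union_right {A B : Finset ℕ} (h : Disjoint A B) (D : Finset ℕ) :
    sortSign D (A ∪ B) = sortSign D A * sortSign D B := by
  simp only [sortSign, invCount_union_right h, pow_add]

theorem flux_signature_identity_fig2 (L C : Finset ℕ) (j : ℕ)
    (hLC : Disjoint L C) (hj : j ∈ C) :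
    sortSign (C \ {j}) {j} * sortSign L C =
      sortSign L (C \ {j}) * sortSign ((C \ {j}) ∪ L) {j} := by
  have hC : sortSign L C = sortSign L (C \ {j}) * sortSign L {j} := by
    rw [← sortSign_union_right Finset.sdiff_disjoint,
      Finset.sdiff_union_of_subset (Finset.singleton_subset_iff.mpr hj)]
  rw [hC, sortSign_union_left (hLC.symm.mono_left Finset.sdiff_subset)]
  ring
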